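/- arXiv:2305.18113 — 4 statements merged into one kernel-verified Lean document; each statement's English description precedes it below -/
import Mathlib

section
/- Let A be an associative algebra over ℂ and let a, b ∈ A satisfy a*b - b*a = 1, and let x, y ∈ ℂ. Then for every natural number n, (x • a + y • b)^n = Σ_{m=0}^{⌊n/2⌋} (n! * (x*y)^m / (m! * (n-2m)! * 2^m)) • ( Σ_{r=0}^{n-2m} (binomial coefficient C(n-2m, r)) * x^r * y^(n-2m-r) • (b^(n-2m-r) * a^r) ), where the outer coefficient n!/(m!*(n-2m)!*2^m) and the binomial coefficients are taken as complex numbers. -/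
noncomputable def dpw {A : Type*} [Ring A] [Algebra ℂ A] (x : ℂ) (a : A) (i : ℕ) : A :=
  (x ^ i / (i.factorial : ℂ)) • a ^ i

noncomputable def nrm {A : Type*} [Ring A] [Algebra ℂ A] (x y : ℂ) (a b : A) (k : ℕ) : A :=
  ∑ p ∈ Finset.HasAntidiagonal.antidiagonal k, dpw y b p.1 * dpw x a p.2

noncomputable def nrmG {A : Type*} [Ring A] [Algebra ℂ A] (x y : ℂ) (a b : A) (m n : ℕ) : A :=
  if 2 * m ≤ n then nrm x y a b (n - 2 * m) else 0

theorem dpw_succ {A : Type*} [Ring A] [Algebra ℂ A] (x : ℂ) (a : A) (i : ℕ) :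
    (x • a) * dpw x a i = ((i : ℂ) + 1) • dpw x a (i + 1) := by
  have h1 : (i.factorial : ℂ) ≠ 0 := by exact_mod_cast i.factorial_ne_zero
  have h2 : (i : ℂ) + 1 ≠ 0 := by exact_mod_cast i.succ_ne_zero
  simp only [dpw, smul_mul_smul_comm, smul_smul, ← pow_succ']
  congr 1
  rw [Nat.factorial_succ]
  push_cast
  field_simp
  ring

theorem comm_pow {A : Type*} [Ring A] (a b : A) (h : a * b - b * a = 1) (i : ℕ) :
    a * b ^ (i + 1) = b ^ (i + 1) * a + ((i + 1 : ℕ) : A) * b ^ i := by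
  have h' : a * b = b * a + 1 := by rw [← h]; abel
  induction i with
  | zero => simp [h']
  | succ i ih =>
    rw [pow_succ b (i + 1), ← mul_assoc, ih, add_mul, mul_assoc _ a b, h', mul_assoc _ (b ^ i),
      ← pow_succ]
    push_cast
    noncomm_ring

theorem dpw_comm {A : Type*} [Ring A] [Algebra ℂ A] (x y : ℂ) (a b : A)
    (h : a * b - b * a = 1) (i : ℕ) :
    (x • a) * dpw y b (i + 1) = dpw y b (i + 1) * (x • a) + (x * y) • dpw y b i := by
  have h1 : (i.factorial : ℂ) ≠ 0 := by exact_mod_cast i.factorial_ne_zero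
  have h2 : (i : ℂ) + 1 ≠ 0 := by exact_mod_cast i.succ_ne_zero
  have h3 : ((i + 1 : ℕ) : A) * b ^ i = ((i + 1 : ℕ) : ℂ) • b ^ i := by
    rw [Algebra.smul_def]; simp
  simp only [dpw, smul_mul_smul_comm, comm_pow a b h, h3, smul_add, smul_smul]
  congr 2
  · ring
  · rw [Nat.factorial_succ]
    push_cast
    field_simp
    ring

theorem dpw_comm_zero {A : Type*} [Ring A] [Algebra ℂ A] (x y : ℂ) (a b : A) :
    (x • a) * dpw y b 0 = dpw y b 0 * (x • a) := by
  simp [dpw]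

theorem nrm_succ {A : Type*} [Ring A] [Algebra ℂ A] (x y : ℂ) (a b : A) (k : ℕ) :
    ((k : ℂ) + 1) • nrm x y a b (k + 1) =
      ∑ p ∈ Finset.HasAntidiagonal.antidiagonal k, ((y • b) * dpw y b p.1 * dpw x a p.2
        + dpw y b p.1 * ((x • a) * dpw x a p.2)) := by
  have e : ((k : ℂ) + 1) • nrm x y a b (k + 1) =
      ∑ p ∈ Finset.HasAntidiagonal.antidiagonal (k + 1), (p.1 : ℂ) • (dpw y b p.1 * dpw x a p.2)
      + ∑ p ∈ Finset.HasAntidiagonal.antidiagonal (k + 1), (p.2 : ℂ) • (dpw y b p.1 * dpw x a p.2) := by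
    rw [nrm, Finset.smul_sum, ← Finset.sum_add_distrib]
    refine Finset.sum_congr rfl fun p hp => ?_
    rw [← add_smul]
    congr 1
    have := Finset.HasAntidiagonal.mem_antidiagonal.1 hp
    exact_mod_cast this.symm
  rw [e, Finset.Nat.sum_antidiagonal_succ, Finset.Nat.sum_antidiagonal_succ',
    Finset.sum_add_distrib]
  simp only [dpw_succ]
  simp

theorem nrm_rec_zero {A : Type*} [Ring A] [Algebra ℂ A] (x y : ℂ) (a b : A) :
    (x • a + y • b) * nrm x y a b 0 = nrm x y a b 1 := by
  simp [nrm, dpw, Finset.Nat.antidiagonal_succ]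

theorem nrm_rec {A : Type*} [Ring A] [Algebra ℂ A] (x y : ℂ) (a b : A)
    (h : a * b - b * a = 1) (k : ℕ) :
    (x • a + y • b) * nrm x y a b (k + 1) =
      ((k : ℂ) + 2) • nrm x y a b (k + 2) + (x * y) • nrm x y a b k := by
  have e := nrm_succ x y a b (k + 1)
  have e2 : (((k + 1 : ℕ) : ℂ) + 1) = (k : ℂ) + 2 := by push_cast; ring
  rw [e2] at e
  rw [e, Finset.sum_add_distrib, add_mul]
  have e3 : (x • a) * nrm x y a b (k + 1) =
      ∑ p ∈ Finset.HasAntidiagonal.antidiagonal (k + 1), dpw y b p.1 * ((x • a) * dpw x a p.2)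
      + (x * y) • nrm x y a b k := by
    rw [nrm, Finset.mul_sum, Finset.Nat.sum_antidiagonal_succ, Finset.Nat.sum_antidiagonal_succ,
      nrm, Finset.smul_sum, add_assoc, ← Finset.sum_add_distrib]
    congr 1
    · rw [← mul_assoc, dpw_comm_zero, mul_assoc]
    · refine Finset.sum_congr rfl fun p _ => ?_
      rw [← mul_assoc, dpw_comm x y a b h, add_mul, mul_assoc,
        smul_mul_assoc (x * y)]
  rw [e3, nrm.eq_def x y a b (k + 1), Finset.mul_sum]
  simp only [mul_assoc]
  abel

theorem nrmG_rec {A : Type*} [Ring A] [Algebra ℂ A] (x y : ℂ) (a b : A)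
    (h : a * b - b * a = 1) (m n : ℕ) :
    (x • a + y • b) * nrmG x y a b m n =
      ((n : ℂ) + 1 - 2 * m) • nrmG x y a b m (n + 1)
        + (x * y) • nrmG x y a b (m + 1) (n + 1) := by
  unfold nrmG
  by_cases h1 : 2 * m ≤ n
  · obtain ⟨k, rfl⟩ := Nat.exists_eq_add_of_le h1
    rw [if_pos h1, if_pos (by omega)]
    cases k with
    | zero =>
      rw [if_neg (by omega)]
      simp [nrm_rec_zero]
    | succ k =>
      rw [if_pos (by omega), show 2 * m + (k + 1) - 2 * m = k + 1 by omega,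
        show 2 * m + (k + 1) + 1 - 2 * m = k + 2 by omega,
        show 2 * m + (k + 1) + 1 - 2 * (m + 1) = k by omega, nrm_rec x y a b h]
      congr 2
      push_cast
      ring
  · rw [if_neg h1, if_neg (by omega : ¬ 2 * (m + 1) ≤ n + 1)]
    by_cases h2 : 2 * m = n + 1
    · have : (n : ℂ) + 1 - 2 * m = 0 := by
        rw [sub_eq_zero]; exact_mod_cast h2.symm
      simp [this]
    · rw [if_neg (by omega)]
      simp

theorem F_rec {A : Type*} [Ring A] [Algebra ℂ A] (x y : ℂ) (a b : A)
    (h : a * b - b * a = 1) (n M : ℕ) (hM : n + 1 < 2 * M) :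
    (x • a + y • b) * ∑ m ∈ Finset.range M,
        ((x * y) ^ m / ((m.factorial : ℂ) * 2 ^ m)) • nrmG x y a b m n =
      ((n : ℂ) + 1) • ∑ m ∈ Finset.range M,
        ((x * y) ^ m / ((m.factorial : ℂ) * 2 ^ m)) • nrmG x y a b m (n + 1) := by
  have z : nrmG x y a b M (n + 1) = 0 := by rw [nrmG, if_neg (by omega)]
  have s : ∑ m ∈ Finset.range M, ((x * y) ^ m / ((m.factorial : ℂ) * 2 ^ m)) •
      ((x * y) • nrmG x y a b (m + 1) (n + 1)) =
      ∑ m ∈ Finset.range M, ((2 : ℂ) * m) • (((x * y) ^ m / ((m.factorial : ℂ) * 2 ^ m)) •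
        nrmG x y a b m (n + 1)) := by
    have t := Finset.sum_range_succ (fun m : ℕ => ((2 : ℂ) * m) •
      (((x * y) ^ m / ((m.factorial : ℂ) * 2 ^ m)) • nrmG x y a b m (n + 1))) M
    rw [Finset.sum_range_succ'] at t
    simp only [z, smul_zero, add_zero, Nat.cast_zero, mul_zero, zero_smul] at t
    rw [← t]
    refine Finset.sum_congr rfl fun m _ => ?_
    have h1 : (m.factorial : ℂ) ≠ 0 := by exact_mod_cast m.factorial_ne_zero
    have h2 : (m : ℂ) + 1 ≠ 0 := by exact_mod_cast m.succ_ne_zero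
    simp only [smul_smul]
    congr 1
    rw [Nat.factorial_succ]
    push_cast
    field_simp
    ring
  rw [Finset.mul_sum, Finset.smul_sum]
  simp only [mul_smul_comm, nrmG_rec x y a b h, smul_add]
  rw [Finset.sum_add_distrib, s, ← Finset.sum_add_distrib]
  refine Finset.sum_congr rfl fun m _ => ?_
  simp only [smul_smul]
  rw [← add_smul]
  congr 1
  ring

theorem pow_eq_F {A : Type*} [Ring A] [Algebra ℂ A] (x y : ℂ) (a b : A)
    (h : a * b - b * a = 1) (M : ℕ) (n : ℕ) (hM : n < 2 * M) :
    (x • a + y • b) ^ n = (n.factorial : ℂ) • ∑ m ∈ Finset.range M,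
        ((x * y) ^ m / ((m.factorial : ℂ) * 2 ^ m)) • nrmG x y a b m n := by
  induction n with
  | zero =>
    obtain ⟨M, rfl⟩ : ∃ k, M = k + 1 := ⟨M - 1, by omega⟩
    rw [Finset.sum_range_succ', Finset.sum_eq_zero]
    · simp [nrmG, nrm, dpw]
    · intro m _
      simp [nrmG]
  | succ n ih =>
    rw [pow_succ', ih (by omega), mul_smul_comm, F_rec x y a b h n M hM, smul_smul,
      Nat.factorial_succ]
    congr 1
    push_cast
    ring

theorem nrm_eq {A : Type*} [Ring A] [Algebra ℂ A] (x y : ℂ) (a b : A) (k : ℕ) :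
    ∑ r ∈ Finset.range (k + 1), (((k.choose r : ℂ)) * x ^ r * y ^ (k - r)) •
      (b ^ (k - r) * a ^ r) = (k.factorial : ℂ) • nrm x y a b k := by
  rw [nrm, ← Finset.Nat.sum_antidiagonal_swap, Finset.Nat.sum_antidiagonal_eq_sum_range_succ_mk,
    Finset.smul_sum]
  refine Finset.sum_congr rfl fun r hr => ?_
  have hr' : r ≤ k := by simpa [Nat.lt_succ_iff] using hr
  have h1 : (r.factorial : ℂ) ≠ 0 := by exact_mod_cast r.factorial_ne_zero
  have h2 : ((k - r).factorial : ℂ) ≠ 0 := by exact_mod_cast (k - r).factorial_ne_zero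
  simp only [Prod.swap, dpw, smul_mul_smul_comm, smul_smul]
  congr 1
  rw [Nat.cast_choose ℂ hr']
  field_simp

open Finset in
theorem pow_linear_combination_normal_order
    {A : Type*} [Ring A] [Algebra ℂ A] (a b : A) (h : a * b - b * a = 1)
    (x y : ℂ) (n : ℕ) :
    (x • a + y • b) ^ n
      = ∑ m ∈ Finset.range (n / 2 + 1),
          ((n.factorial : ℂ) * (x * y) ^ m
              / ((m.factorial : ℂ) * ((n - 2 * m).factorial : ℂ) * 2 ^ m)) •
            ∑ r ∈ Finset.range (n - 2 * m + 1),
              ((((n - 2 * m).choose r : ℂ)) * x ^ r * y ^ (n - 2 * m - r)) •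
                (b ^ (n - 2 * m - r) * a ^ r) := by
  rw [pow_eq_F x y a b h (n / 2 + 1) n (by omega), Finset.smul_sum]
  refine Finset.sum_congr rfl fun m hm => ?_
  have hm' : 2 * m ≤ n := by
    have := Finset.mem_range.1 hm
    omega
  have h2 : ((n - 2 * m).factorial : ℂ) ≠ 0 := by exact_mod_cast (n - 2 * m).factorial_ne_zero
  have h1 : (m.factorial : ℂ) ≠ 0 := by exact_mod_cast m.factorial_ne_zero
  rw [nrm_eq, nrmG, if_pos hm', smul_smul, smul_smul]
  congr 1
  field_simp
end

section
/- Let V be a vector space over ℂ, let A, B : V → V be linear operators with A∘B - B∘A = id_V, let v ∈ V satisfy A v = 0, and let x, y ∈ ℂ. Then for every natural number n, ((x • A + y • B)^n) v = Σ_{m=0}^{⌊n/2⌋} (n! / (m! * (n-2m)! * 2^m)) * x^m * y^(n-m) • (B^(n-2m) v), where the coefficient n!/(m!*(n-2m)!*2^m) is taken as a complex number. -/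
noncomputable def vacC (n m : ℕ) : ℂ :=
  if 2 * m ≤ n then (n.factorial : ℂ)
    / ((m.factorial : ℂ) * ((n - 2 * m).factorial : ℂ) * 2 ^ m) else 0

theorem vacC_zero (n : ℕ) : vacC n 0 = 1 := by
  have : (n.factorial : ℂ) ≠ 0 := by exact_mod_cast n.factorial_ne_zero
  simp [vacC, this]

theorem vacC_big (n m : ℕ) (h : n < 2 * m) : vacC n m = 0 := by
  simp [vacC, h]

theorem vacC_add (k m : ℕ) : vacC (2 * m + k) m = ((2 * m + k).factorial : ℂ)
    / ((m.factorial : ℂ) * (k.factorial : ℂ) * 2 ^ m) := by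
  simp [vacC]

theorem vacC_succ (n m : ℕ) :
    vacC (n + 1) (m + 1) = ((n - 2 * m : ℕ) : ℂ) * vacC n m + vacC n (m + 1) := by
  have hm : (m.factorial : ℂ) ≠ 0 := by exact_mod_cast m.factorial_ne_zero
  have hm1 : (m : ℂ) + 1 ≠ 0 := by exact_mod_cast m.succ_ne_zero
  rcases Nat.lt_or_ge (2 * m) n with h1 | h1
  · obtain ⟨k, rfl⟩ : ∃ k, n = 2 * m + (k + 1) := ⟨n - 2 * m - 1, by omega⟩
    have hk : (k.factorial : ℂ) ≠ 0 := by exact_mod_cast k.factorial_ne_zero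
    have hk1 : (k : ℂ) + 1 ≠ 0 := by exact_mod_cast k.succ_ne_zero
    have e1 : 2 * m + (k + 1) + 1 = 2 * (m + 1) + k := by ring
    have e2 : (2 * (m + 1) + k).factorial
        = (2 * m + k + 2) * (2 * m + (k + 1)).factorial := by
      rw [← e1, Nat.factorial_succ]; ring
    rw [e1, vacC_add, vacC_add, e2, Nat.add_sub_cancel_left]
    rcases k with _ | j
    · rw [vacC_big _ (m + 1) (by omega)]
      simp only [Nat.factorial_succ, Nat.factorial_zero]
      push_cast
      field_simp
      ring
    · have e3 : 2 * m + (j + 1 + 1) = 2 * (m + 1) + j := by ring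
      have hj : (j.factorial : ℂ) ≠ 0 := by exact_mod_cast j.factorial_ne_zero
      have hj1 : (j : ℂ) + 1 ≠ 0 := by exact_mod_cast j.succ_ne_zero
      push_cast at hk1
      rw [e3, vacC_add]
      generalize (2 * (m + 1) + j).factorial = F
      simp only [Nat.factorial_succ]
      push_cast
      field_simp
      ring
  · rw [vacC_big _ _ (by omega), vacC_big n (m + 1) (by omega), Nat.sub_eq_zero_of_le h1]
    simp

theorem vac_AB {V : Type*} [AddCommGroup V] [Module ℂ V]
    (A B : Module.End ℂ V) (h : A ∘ₗ B - B ∘ₗ A = LinearMap.id)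
    (v : V) (hv : A v = 0) (k : ℕ) : A ((B ^ k) v) = (k : ℂ) • (B ^ (k - 1)) v := by
  have hc : ∀ w, A (B w) = B (A w) + w := fun w => by
    have := LinearMap.congr_fun h w
    simp only [LinearMap.sub_apply, LinearMap.comp_apply, LinearMap.id_apply] at this
    exact sub_eq_iff_eq_add'.1 this
  induction k with
  | zero => simp [hv]
  | succ k ih =>
    rw [pow_succ', Module.End.mul_apply, hc, ih, map_smul, Nat.add_sub_cancel]
    rcases k with _ | k
    · simp
    · rw [Nat.add_sub_cancel, ← Module.End.mul_apply, ← pow_succ']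
      push_cast
      module

theorem vac_aux {V : Type*} [AddCommGroup V] [Module ℂ V]
    (A B : Module.End ℂ V) (h : A ∘ₗ B - B ∘ₗ A = LinearMap.id)
    (v : V) (hv : A v = 0) (x y : ℂ) (n : ℕ) :
    ((x • A + y • B) ^ n) v
      = ∑ m ∈ Finset.range (n + 1),
          (vacC n m * x ^ m * y ^ (n - m)) • ((B ^ (n - 2 * m)) v) := by
  induction n with
  | zero => simp [vacC_zero]
  | succ n ih =>
    rw [pow_succ', Module.End.mul_apply, ih, map_sum]
    have step : ∀ m ∈ Finset.range (n + 1), (x • A + y • B)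
        ((vacC n m * x ^ m * y ^ (n - m)) • ((B ^ (n - 2 * m)) v))
        = (((n - 2 * m : ℕ) : ℂ) * vacC n m * x ^ (m + 1) * y ^ (n - m)) •
            ((B ^ (n + 1 - 2 * (m + 1))) v)
          + (vacC n m * x ^ m * y ^ (n + 1 - m)) • ((B ^ (n + 1 - 2 * m)) v) := by
      intro m hm
      have hm : m ≤ n := by simpa [Nat.lt_succ_iff] using hm
      rcases Nat.lt_or_ge n (2 * m) with h2 | h2
      · simp [vacC_big n m h2]
      · rw [map_smul, LinearMap.add_apply, LinearMap.smul_apply, LinearMap.smul_apply,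
          vac_AB A B h v hv, ← Module.End.mul_apply, ← pow_succ',
          show n + 1 - 2 * (m + 1) = n - 2 * m - 1 by omega,
          show n + 1 - 2 * m = n - 2 * m + 1 by omega,
          show n + 1 - m = n - m + 1 by omega]
        module
    rw [Finset.sum_congr rfl step, Finset.sum_add_distrib]
    have e : ∑ m ∈ Finset.range (n + 1),
        (vacC n m * x ^ m * y ^ (n + 1 - m)) • ((B ^ (n + 1 - 2 * m)) v)
        = ∑ m ∈ Finset.range (n + 1 + 1),
        (vacC n m * x ^ m * y ^ (n + 1 - m)) • ((B ^ (n + 1 - 2 * m)) v) := by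
      rw [Finset.sum_range_succ _ (n + 1), vacC_big n (n + 1) (by omega)]
      simp
    rw [e, Finset.sum_range_succ' _ (n + 1), Finset.sum_range_succ' _ (n + 1), ← add_assoc,
      ← Finset.sum_add_distrib, vacC_zero, vacC_zero]
    congr 1
    refine Finset.sum_congr rfl fun m _ => ?_
    rw [vacC_succ, Nat.add_sub_add_right]
    module



open Finset in
theorem pow_linear_combination_on_vacuum
    {V : Type*} [AddCommGroup V] [Module ℂ V]
    (A B : Module.End ℂ V) (h : A ∘ₗ B - B ∘ₗ A = LinearMap.id)
    (v : V) (hv : A v = 0) (x y : ℂ) (n : ℕ) :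
    ((x • A + y • B) ^ n) v
      = ∑ m ∈ Finset.range (n / 2 + 1),
          (((n.factorial : ℂ)
              / ((m.factorial : ℂ) * ((n - 2 * m).factorial : ℂ) * 2 ^ m))
            * x ^ m * y ^ (n - m)) • ((B ^ (n - 2 * m)) v) := by
  rw [vac_aux A B h v hv x y n]
  symm
  rw [← Finset.sum_subset (Finset.range_subset_range.2 (show n / 2 + 1 ≤ n + 1 by omega))]
  · refine Finset.sum_congr rfl fun m hm => ?_
    have : 2 * m ≤ n := by have := Finset.mem_range.1 hm; omega
    rw [vacC, if_pos this]
  · intro m _ hm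
    rw [vacC_big n m (by rw [Finset.mem_range] at hm; omega)]
    simp
end

section
/- Let A be a (possibly noncommutative) ring and let a, b ∈ A satisfy a*b - b*a = 1. Then for all natural numbers j and k, a^j * b^k = Σ_{s=0}^{min(j,k)} (s! * C(j,s) * C(k,s)) * (b^(k-s) * a^(j-s)), where s! * C(j,s) * C(k,s) = j! k! / (s! (j-s)! (k-s)!) is a natural-number coefficient acting by scalar multiplication. -/
theorem aux_comm {A : Type*} [Ring A] (a b : A) (h : a * b - b * a = 1) (m : ℕ) :
    a * b ^ m = b ^ m * a + m • b ^ (m - 1) := by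
  have h' : a * b = b * a + 1 := by rw [← h]; abel
  induction m with
  | zero => simp
  | succ m ih =>
    rw [pow_succ, ← mul_assoc, ih, add_mul, mul_assoc, h', mul_add, mul_one, ← mul_assoc]
    rcases m with _ | m
    · simp
    · simp only [Nat.add_sub_cancel, smul_mul_assoc, ← pow_succ]
      rw [succ_nsmul _ (m + 1)]
      abel

theorem aux_main {A : Type*} [Ring A] (a b : A) (h : a * b - b * a = 1) (j k : ℕ) :
    a ^ j * b ^ k
      = ∑ s ∈ Finset.range (j + 1),
          (s.factorial * j.choose s * k.choose s) • (b ^ (k - s) * a ^ (j - s)) := by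
  induction j with
  | zero => simp
  | succ j ih =>
    have e1 : ∀ s ∈ Finset.range (j + 1),
        a * ((s.factorial * j.choose s * k.choose s) • (b ^ (k - s) * a ^ (j - s)))
        = (s.factorial * j.choose s * k.choose s) • (b ^ (k - s) * a ^ (j + 1 - s))
          + (s.factorial * j.choose s * k.choose s * (k - s)) •
            (b ^ (k - (s + 1)) * a ^ (j + 1 - (s + 1))) := by
      intro s hs
      have hs' : s ≤ j := by simpa [Nat.lt_succ_iff] using hs
      rw [mul_smul_comm, ← mul_assoc, aux_comm a b h, add_mul, smul_add, mul_assoc (b ^ (k - s)) a, ← pow_succ',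
        smul_mul_assoc, smul_smul, Nat.sub_sub, Nat.add_sub_add_right, Nat.sub_add_comm hs']
    have e2 : ∀ s, (s + 1).factorial * (j + 1).choose (s + 1) * k.choose (s + 1)
        = (s + 1).factorial * j.choose (s + 1) * k.choose (s + 1)
          + s.factorial * j.choose s * k.choose s * (k - s) := by
      intro s
      have := Nat.choose_succ_right_eq k s
      rw [Nat.choose_succ_succ, mul_assoc _ (k.choose s), ← this, Nat.factorial_succ]
      ring
    rw [pow_succ', mul_assoc, ih, Finset.mul_sum, Finset.sum_congr rfl e1,
      Finset.sum_add_distrib, Finset.sum_range_succ' _ (j + 1)]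
    simp only [e2, add_smul, Finset.sum_add_distrib]
    have e3 := Finset.sum_range_succ' (fun s => (s.factorial * j.choose s * k.choose s) •
      (b ^ (k - s) * a ^ (j + 1 - s))) (j + 1)
    rw [Finset.sum_range_succ] at e3
    simp only [Nat.choose_succ_self, mul_zero, zero_mul, zero_smul, add_zero,
      Nat.choose_zero_right] at e3 ⊢
    rw [e3]
    abel

open Finset in
theorem normal_ordering_a_pow_b_pow
    {A : Type*} [Ring A] (a b : A) (h : a * b - b * a = 1) (j k : ℕ) :
    a ^ j * b ^ k
      = ∑ s ∈ Finset.range (min j k + 1),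
          (s.factorial * j.choose s * k.choose s) • (b ^ (k - s) * a ^ (j - s)) := by
  rw [aux_main a b h]
  symm
  apply Finset.sum_subset
  · intro s hs
    simp only [Finset.mem_range] at *
    omega
  · intro s hs hn
    simp only [Finset.mem_range] at *
    rw [Nat.choose_eq_zero_of_lt (show k < s by omega)]
    simp
end

section
/- Let A be a (possibly noncommutative) ring and let a, b ∈ A satisfy a*b - b*a = 1. Then for all natural numbers j and k, b^j * a^k = Σ_{s=0}^{min(j,k)} (-1)^s * (s! * C(j,s) * C(k,s)) * (a^(k-s) * b^(j-s)), where s! * C(j,s) * C(k,s) = j! k! / (s! (j-s)! (k-s)!) is a natural-number coefficient and (-1)^s accounts for the alternating sign (so the statement is an identity in A, with integer scalar multiples). -/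
theorem b_mul_a_pow_aux {A : Type*} [Ring A] (a b : A) (h : a * b - b * a = 1) (m : ℕ) :
    b * a ^ m = a ^ m * b - (m : ℤ) • a ^ (m - 1) := by
  have hba : b * a = a * b - 1 := by rw [← h]; abel
  induction m with
  | zero => simp
  | succ m ih =>
    rw [pow_succ, ← mul_assoc, ih, sub_mul, mul_assoc, hba, mul_sub, smul_mul_assoc]
    have : (m : ℤ) • (a ^ (m - 1) * a) = (m : ℤ) • a ^ m := by
      cases m with
      | zero => simp
      | succ n => simp [pow_succ]
    rw [this, Nat.add_sub_cancel]
    push_cast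
    rw [add_smul, one_smul, mul_one, mul_assoc]
    abel

theorem antinormal_aux {A : Type*} [Ring A] (a b : A) (h : a * b - b * a = 1) (j k : ℕ) :
    b ^ j * a ^ k
      = ∑ s ∈ Finset.range (j + 1),
          ((-1 : ℤ) ^ s * (s.factorial * j.choose s * k.choose s)) •
            (a ^ (k - s) * b ^ (j - s)) := by
  induction j with
  | zero => simp
  | succ j ih =>
    have key : ∑ s ∈ Finset.range (j + 1),
          ((-1 : ℤ) ^ s * (s.factorial * j.choose s * k.choose s)) •
            (a ^ (k - s) * b ^ (j + 1 - s)) = a ^ k * b ^ (j + 1) +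
        ∑ s ∈ Finset.range (j + 1),
          ((-1 : ℤ) ^ (s + 1) * ((s + 1).factorial * j.choose (s + 1) * k.choose (s + 1))) •
            (a ^ (k - (s + 1)) * b ^ (j - s)) := by
      have e := Finset.sum_range_succ (fun s => ((-1 : ℤ) ^ s *
        (s.factorial * j.choose s * k.choose s)) • (a ^ (k - s) * b ^ (j + 1 - s))) (j + 1)
      rw [Finset.sum_range_succ'] at e
      simp only [Nat.choose_succ_self, Nat.cast_zero, mul_zero, zero_mul, zero_smul, add_zero] at e
      rw [← e, add_comm]
      simp
    have step : b ^ (j + 1) * a ^ k = ∑ s ∈ Finset.range (j + 1),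
          ((-1 : ℤ) ^ s * (s.factorial * j.choose s * k.choose s)) •
            (a ^ (k - s) * b ^ (j + 1 - s)) - ∑ s ∈ Finset.range (j + 1),
          ((-1 : ℤ) ^ s * (s.factorial * j.choose s * k.choose s) * ((k - s : ℕ) : ℤ)) •
            (a ^ (k - (s + 1)) * b ^ (j - s)) := by
      rw [pow_succ', mul_assoc, ih, Finset.mul_sum, ← Finset.sum_sub_distrib]
      refine Finset.sum_congr rfl fun s hs => ?_
      have hs' : s ≤ j := Nat.lt_succ_iff.mp (Finset.mem_range.mp hs)
      rw [mul_smul_comm, ← mul_assoc b, b_mul_a_pow_aux a b h, sub_mul, smul_sub, mul_assoc _ b,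
        ← pow_succ', smul_mul_assoc, smul_smul, Nat.sub_sub, Nat.succ_sub hs']
    rw [step, key, Finset.sum_range_succ' _ (j + 1), add_sub_assoc, ← Finset.sum_sub_distrib,
      add_comm (a ^ k * b ^ (j + 1))]
    congr 1
    · refine Finset.sum_congr rfl fun s _ => ?_
      rw [← sub_smul, Nat.add_sub_add_right]
      congr 1
      have hc : ((k.choose (s + 1) : ℕ) : ℤ) * (s + 1) = k.choose s * ((k - s : ℕ) : ℤ) := by
        exact_mod_cast Nat.choose_succ_right_eq k s
      rw [Nat.choose_succ_succ, Nat.factorial_succ]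
      push_cast
      linear_combination ((-1 : ℤ) ^ s * s.factorial * j.choose s) * hc
    · simp

open Finset in
theorem antinormal_ordering_b_pow_a_pow
    {A : Type*} [Ring A] (a b : A) (h : a * b - b * a = 1) (j k : ℕ) :
    b ^ j * a ^ k
      = ∑ s ∈ Finset.range (min j k + 1),
          ((-1 : ℤ) ^ s * (s.factorial * j.choose s * k.choose s)) •
            (a ^ (k - s) * b ^ (j - s)) := by
  rw [antinormal_aux a b h]
  symm
  apply Finset.sum_subset
  · intro s hs
    simp only [Finset.mem_range] at *
    omega
  · intro s hs hs'
    simp only [Finset.mem_range] at *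
    rw [Nat.choose_eq_zero_of_lt (show k < s by omega)]
    simp
end
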